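/- arXiv:1603.04386 — 4 statements merged into one kernel-verified Lean document; each statement's English description precedes it below -/
import Mathlib

section
/- Let n be a positive integer and let ρ, σ be permutations of Fin n. There exists a permutation F of Fin n → Bool satisfying ρ' ∘ F ∘ σ' = F if and only if ρ and σ have the same cycle type (i.e. for every i, ρ and σ have the same number of cycles of length i, fixed points counted as cycles of length 1). -/
/-- The number of cycles of length `i` of a permutation of a finite set,
with fixed points counted as cycles of length 1. -/
def cycleCount {α : Type*} [Fintype α] [DecidableEq α] (σ : Equiv.Perm α) (i : ℕ) : ℕ :=
  if i = 1 then Fintype.card α - σ.support.card else σ.cycleType.count i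

/-- The permutation `σ'` of `Fin n → Bool` induced by a permutation `σ` of `Fin n`,
given by `σ'(x) = x ∘ σ`. -/
def induced {n : ℕ} (σ : Equiv.Perm (Fin n)) : Equiv.Perm (Fin n → Bool) where
  toFun x := x ∘ σ
  invFun x := x ∘ σ.symm
  left_inv x := by funext i; simp
  right_inv x := by funext i; simp

open Equiv Equiv.Perm in
/-- Fixed points of a power of `σ` are the points whose cycle length divides the exponent. -/
theorem pow_apply_eq_self_iff_orderOf_cycleOf_dvd {α : Type*} [Fintype α] [DecidableEq α]
    (σ : Perm α) (x : α) (m : ℕ) :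
    (σ ^ m) x = x ↔ orderOf (σ.cycleOf x) ∣ m := by
  rw [orderOf_dvd_iff_pow_eq_one, ← cycleOf_pow_apply_self]
  by_cases hx : σ x = x
  · simp [(cycleOf_eq_one_iff σ).2 hx]
  · refine ((isCycle_cycleOf σ hx).pow_eq_one_iff' ?_).symm
    rwa [cycleOf_apply_self]

/-- The fibres over positive numbers of a function on a finite type have sizes determined by the
numbers of points whose value divides each `m`. -/
theorem card_fiber_eq_of_card_dvd_eq {α : Type*} [Fintype α] (e f : α → ℕ)
    (h : ∀ m, 0 < m → (Finset.univ.filter fun x => e x ∣ m).card =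
      (Finset.univ.filter fun x => f x ∣ m).card) (d : ℕ) (hd : 0 < d) :
    (Finset.univ.filter fun x => e x = d).card = (Finset.univ.filter fun x => f x = d).card := by
  have key : ∀ (g : α → ℕ) (m : ℕ), 0 < m → (Finset.univ.filter fun x => g x ∣ m).card =
      ∑ k ∈ m.properDivisors, (Finset.univ.filter fun x => g x = k).card +
        (Finset.univ.filter fun x => g x = m).card := by
    intro g m hm
    rw [add_comm,
      ← Finset.sum_cons (f := fun k => (Finset.univ.filter fun x => g x = k).card)
        Nat.self_notMem_properDivisors,
      Nat.cons_self_properDivisors hm.ne',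
      Finset.card_eq_sum_card_fiberwise (f := g) (t := m.divisors)]
    · refine Finset.sum_congr rfl fun k hk => ?_
      rw [Finset.filter_filter]
      congr 1
      ext x
      simp only [Finset.mem_filter, Finset.mem_univ, true_and, and_iff_right_iff_imp]
      rintro rfl
      exact Nat.dvd_of_mem_divisors hk
    · intro x hx
      exact Nat.mem_divisors.2 ⟨(Finset.mem_filter.1 hx).2, hm.ne'⟩
  induction d using Nat.strong_induction_on with
  | _ d ih =>
    have h' := h d hd
    rw [key e d hd, key f d hd, Finset.sum_congr rfl fun k hk => ih k
      (Nat.mem_properDivisors.1 hk).2 (Nat.pos_of_mem_properDivisors hk)] at h'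
    exact Nat.add_left_cancel h'

open Equiv Equiv.Perm in
/-- The points lying on a cycle of length `i ≥ 2` number `i` times the count of such cycles. -/
theorem card_orderOf_cycleOf_eq {α : Type*} [Fintype α] [DecidableEq α]
    (σ : Perm α) (i : ℕ) (hi : 2 ≤ i) :
    (Finset.univ.filter fun x => orderOf (σ.cycleOf x) = i).card = σ.cycleType.count i * i := by
  have hset : (Finset.univ.filter fun x => orderOf (σ.cycleOf x) = i) =
      (σ.cycleFactorsFinset.filter fun c => c.support.card = i).biUnion support := by
    ext x
    simp only [Finset.mem_filter, Finset.mem_univ, true_and, Finset.mem_biUnion]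
    constructor
    · intro h
      have hx : σ x ≠ x := by
        intro hx
        rw [(cycleOf_eq_one_iff σ).2 hx, orderOf_one] at h
        omega
      refine ⟨σ.cycleOf x, ⟨cycleOf_mem_cycleFactorsFinset_iff.2 (mem_support.2 hx), ?_⟩, ?_⟩
      · rw [← (isCycle_cycleOf σ hx).orderOf, h]
      · rw [mem_support, cycleOf_apply_self]
        exact hx
    · rintro ⟨c, ⟨hc, hci⟩, hxc⟩
      rw [← cycle_is_cycleOf hxc hc, (mem_cycleFactorsFinset_iff.1 hc).1.orderOf, hci]
  rw [hset, Finset.card_biUnion, Finset.sum_const_nat (m := i), cycleType_def, Multiset.count_map]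
  · congr 1
    simp only [Finset.card_def, Finset.filter_val, Function.comp_apply, eq_comm]
    rfl
  · intro c hc
    exact (Finset.mem_filter.1 hc).2
  · intro c hc d hd hcd
    exact (cycleFactorsFinset_pairwise_disjoint σ (Finset.mem_filter.1 hc).1
      (Finset.mem_filter.1 hd).1 hcd).disjoint_support

open Equiv in
/-- Two permutations whose powers have equally many fixed points have the same cycle counts. -/
theorem cycleCount_eq_of_card_fixed_pow_eq {α : Type*} [Fintype α] [DecidableEq α]
    (ρ σ : Perm α)
    (h : ∀ m : ℕ, (Finset.univ.filter fun x => (ρ ^ m) x = x).card =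
      (Finset.univ.filter fun x => (σ ^ m) x = x).card) (i : ℕ) :
    cycleCount ρ i = cycleCount σ i := by
  have hdvd := card_fiber_eq_of_card_dvd_eq (fun x => orderOf (ρ.cycleOf x))
    (fun x => orderOf (σ.cycleOf x)) fun m _ => by
      simpa only [pow_apply_eq_self_iff_orderOf_cycleOf_dvd] using h m
  have hcard : ∀ τ : Perm α, Fintype.card α - τ.support.card =
      (Finset.univ.filter fun x => τ x = x).card := fun τ => by
    rw [← Finset.card_compl]
    congr 1
    ext x
    simp
  unfold cycleCount
  split_ifs with h1
  · simpa only [hcard, pow_one] using h 1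
  · rcases Nat.eq_zero_or_pos i with rfl | hpos
    · rw [Multiset.count_eq_zero_of_notMem, Multiset.count_eq_zero_of_notMem] <;>
        exact fun hmem => absurd (Perm.two_le_of_mem_cycleType hmem) (by norm_num)
    · have h2 := hdvd i hpos
      rw [card_orderOf_cycleOf_eq ρ i (by omega), card_orderOf_cycleOf_eq σ i (by omega)] at h2
      exact Nat.eq_of_mul_eq_mul_right hpos h2

/-- A function on a finite group that depends only on the cyclic subgroup an element generates, and
whose sum over every subgroup of a given cyclic subgroup vanishes, is zero on that subgroup. -/
theorem eq_zero_of_sum_zpowers_eq_zero {G : Type*} [Group G] [Finite G] (D : G → ℤ)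
    (g : G) (hD : ∀ a b : G, Subgroup.zpowers a = Subgroup.zpowers b → D a = D b)
    (hsum : ∀ a ∈ Subgroup.zpowers g, ∑ᶠ b : Subgroup.zpowers a, D b = 0) :
    ∀ a ∈ Subgroup.zpowers g, D a = 0 := by
  classical
  suffices H : ∀ (k : ℕ) (a : G), a ∈ Subgroup.zpowers g →
      Nat.card (Subgroup.zpowers a) = k → D a = 0 from fun a ha => H _ a ha rfl
  intro k
  induction k using Nat.strong_induction_on with
  | _ k ih =>
    intro a ha hk
    have := Fintype.ofFinite (Subgroup.zpowers a)
    have hterm : ∀ b : Subgroup.zpowers a,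
        D b = if Subgroup.zpowers (b : G) = Subgroup.zpowers a then D a else 0 := by
      intro b
      split_ifs with hb
      · exact hD _ _ hb
      · have hle : Subgroup.zpowers (b : G) ≤ Subgroup.zpowers a :=
          Subgroup.zpowers_le.2 b.2
        refine ih _ ?_ b (Subgroup.zpowers_le.2 ha b.2) rfl
        rw [← hk]
        exact Set.ncard_lt_ncard (SetLike.coe_strictMono (lt_of_le_of_ne hle hb)) (Set.toFinite _)
    have h0 := hsum a ha
    rw [finsum_eq_sum_of_fintype, Finset.sum_congr rfl fun b _ => hterm b, ← Finset.sum_filter,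
      Finset.sum_const, nsmul_eq_mul, mul_eq_zero] at h0
    refine h0.resolve_left ?_
    rw [Nat.cast_eq_zero, Finset.card_eq_zero]
    refine Finset.Nonempty.ne_empty ⟨⟨a, Subgroup.mem_zpowers a⟩, ?_⟩
    simp

/-- For a cyclic group acting through `φ` with generator `h`, the number of orbits governs both
the number of `h`-invariant Boolean functions and the sum of the numbers of fixed points. -/
theorem exists_orbit_count {H α : Type*} [Group H] [Finite H] [Finite α]
    (φ : H →* Equiv.Perm α) (h : H) (hgen : ∀ a, a ∈ Subgroup.zpowers h) :
    ∃ q : ℕ, Nat.card {x : α → Bool // x ∘ φ h = x} = 2 ^ q ∧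
      ∑ᶠ a : H, (Nat.card {x : α // φ a x = x} : ℤ) = q * Nat.card H := by
  classical
  let _ : MulAction H α := MulAction.compHom α φ
  have hsmul : ∀ (a : H) (x : α), a • x = φ a x := fun _ _ => rfl
  have := Fintype.ofFinite H
  have := Fintype.ofFinite α
  refine ⟨Fintype.card (MulAction.orbitRel.Quotient H α), ?_, ?_⟩
  · rw [← Fintype.card_bool, ← Fintype.card_fun, ← Nat.card_eq_fintype_card]
    refine Nat.card_congr ⟨fun x => Quotient.lift x.1 ?_,
      fun f => ⟨fun a => f (Quotient.mk _ a), ?_⟩, ?_, ?_⟩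
    · rintro a b ⟨c, rfl⟩
      have hinv : ∀ c : H, ∀ b : α, x.1 (c • b) = x.1 b := by
        intro c
        obtain ⟨k, rfl⟩ := mem_powers_iff_mem_zpowers.2 (hgen c)
        induction k with
        | zero => simp
        | succ k ih =>
          intro b
          have h1 : x.1 (h • b) = x.1 b := congrFun x.2 b
          simpa only [pow_succ, mul_smul, h1] using ih (h • b)
      exact hinv c b
    · funext a
      exact congrArg f (Quotient.sound ⟨h, rfl⟩)
    · intro x
      rfl
    · intro f
      funext q
      induction q using Quotient.inductionOn with
      | _ a => rfl
  · rw [finsum_eq_sum_of_fintype]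
    have := MulAction.sum_card_fixedBy_eq_card_orbits_mul_card_group H α
    rw [Nat.card_eq_fintype_card, ← Nat.cast_mul, ← this, Nat.cast_sum]
    refine Finset.sum_congr rfl fun a _ => ?_
    rw [← Nat.card_eq_fintype_card]
    rfl

/-- Forming the induced permutation commutes with integer powers. -/
theorem induced_zpow {n : ℕ} (σ : Equiv.Perm (Fin n)) (k : ℤ) :
    induced (σ ^ k) = induced σ ^ k := by
  let φ : Equiv.Perm (Fin n) →* (Equiv.Perm (Fin n → Bool))ᵐᵒᵖ :=
    { toFun := fun τ => MulOpposite.op (induced τ)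
      map_one' := rfl
      map_mul' := fun _ _ => rfl }
  exact congrArg MulOpposite.unop (map_zpow φ σ k)

/-- There is a permutation `F` of `Fin n → Bool` with `ρ' ∘ F ∘ σ' = F`
iff `ρ` and `σ` have the same cycle type (fixed points counted as cycles of length 1). -/
theorem statement3 (n : ℕ) (hn : 0 < n) (ρ σ : Equiv.Perm (Fin n)) :
    (∃ F : Equiv.Perm (Fin n → Bool), induced ρ * F * induced σ = F) ↔
      ∀ i : ℕ, cycleCount ρ i = cycleCount σ i := by
  constructor
  · rintro ⟨F, hF⟩
    let g : Equiv.Perm (Fin n) × Equiv.Perm (Fin n) := (ρ, σ⁻¹)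
    have hsemi : ∀ k : ℤ, SemiconjBy F (induced (g ^ k).2) (induced (g ^ k).1) := by
      intro k
      have h1 : SemiconjBy F (induced σ⁻¹) (induced ρ) := by
        have h2 := induced_zpow σ (-1)
        rw [zpow_neg_one, zpow_neg_one] at h2
        rw [SemiconjBy, h2, mul_inv_eq_iff_eq_mul, hF]
      rw [Prod.pow_fst, Prod.pow_snd, induced_zpow, induced_zpow]
      exact h1.zpow_right k
    have hzero := eq_zero_of_sum_zpowers_eq_zero
      (fun a : Equiv.Perm (Fin n) × Equiv.Perm (Fin n) =>
        (Nat.card {x // a.1 x = x} : ℤ) - Nat.card {x // a.2 x = x}) g ?_ ?_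
    · refine cycleCount_eq_of_card_fixed_pow_eq ρ σ fun m => ?_
      have h1 := hzero (g ^ m) (Subgroup.npow_mem_zpowers g m)
      rw [sub_eq_zero, Nat.cast_inj] at h1
      simp only [g, Prod.pow_mk, Nat.card_eq_fintype_card, Fintype.card_subtype, inv_pow,
        Equiv.Perm.inv_eq_iff_eq] at h1
      simpa only [eq_comm] using h1
    · have hfix : ∀ (φ : Equiv.Perm (Fin n) × Equiv.Perm (Fin n) →* Equiv.Perm (Fin n))
          (a b : Equiv.Perm (Fin n) × Equiv.Perm (Fin n)) (x : Fin n),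
          a ∈ Subgroup.zpowers b → φ b x = x → φ a x = x := by
        rintro φ _ b x ⟨k, rfl⟩ hx
        simp only [map_zpow]
        exact Equiv.Perm.zpow_apply_eq_self_of_apply_eq_self hx k
      intro a b hab
      have ha : a ∈ Subgroup.zpowers b := hab ▸ Subgroup.mem_zpowers a
      have hb : b ∈ Subgroup.zpowers a := hab ▸ Subgroup.mem_zpowers b
      have e1 : ∀ x, a.1 x = x ↔ b.1 x = x := fun x =>
        ⟨hfix (MonoidHom.fst _ _) b a x hb, hfix (MonoidHom.fst _ _) a b x ha⟩
      have e2 : ∀ x, a.2 x = x ↔ b.2 x = x := fun x =>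
        ⟨hfix (MonoidHom.snd _ _) b a x hb, hfix (MonoidHom.snd _ _) a b x ha⟩
      simp only [e1, e2]
    · rintro _ ⟨k, rfl⟩
      have hgen : ∀ a : Subgroup.zpowers (g ^ k),
          a ∈ Subgroup.zpowers (⟨g ^ k, Subgroup.mem_zpowers _⟩ : Subgroup.zpowers (g ^ k)) := by
        rintro ⟨_, j, rfl⟩
        exact ⟨j, rfl⟩
      obtain ⟨p, hp, hp'⟩ := exists_orbit_count
        ((MonoidHom.fst _ _).comp (Subgroup.zpowers (g ^ k)).subtype) _ hgen
      obtain ⟨q, hq, hq'⟩ := exists_orbit_count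
        ((MonoidHom.snd _ _).comp (Subgroup.zpowers (g ^ k)).subtype) _ hgen
      have hpq : p = q := by
        refine Nat.pow_right_injective le_rfl (?_ : 2 ^ p = 2 ^ q)
        rw [← hp, ← hq]
        refine (Nat.card_congr (F.subtypeEquiv fun x => ?_)).symm
        change induced (g ^ k).2 x = x ↔ induced (g ^ k).1 (F x) = F x
        have h1 : F (induced (g ^ k).2 x) = induced (g ^ k).1 (F x) :=
          congrArg (fun P : Equiv.Perm (Fin n → Bool) => P x) (hsemi k)
        rw [← h1, F.injective.eq_iff]
      rw [finsum_sub_distrib (Set.toFinite _) (Set.toFinite _), sub_eq_zero]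
      exact hp'.trans (hpq ▸ hq'.symm)
  · intro h
    have htype : ρ.cycleType = σ⁻¹.cycleType := by
      rw [Equiv.Perm.cycleType_inv]
      ext i
      by_cases hi : i = 1
      · subst hi
        rw [Multiset.count_eq_zero_of_notMem, Multiset.count_eq_zero_of_notMem] <;>
          exact fun hmem => absurd (Equiv.Perm.two_le_of_mem_cycleType hmem) (by norm_num)
      · simpa only [cycleCount, if_neg hi] using h i
    obtain ⟨c, hc⟩ := isConj_iff.1 (Equiv.Perm.isConj_iff_cycleType_eq.2 htype)
    have hσ : σ * c * ρ = c := by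
      rw [mul_inv_eq_iff_eq_mul] at hc
      rw [mul_assoc, hc, mul_inv_cancel_left]
    exact ⟨induced c, congrArg induced hσ⟩
end

section
/- Let X and Y be finite sets with |X| = p and |Y| = q, let α be a permutation of X consisting of a single cycle of length p, and let β be a permutation of Y consisting of a single cycle of length q. Then the permutation α × β of X × Y, defined by (α × β)(x, y) = (α(x), β(y)), decomposes into exactly gcd(p, q) disjoint cycles, each of length lcm(p, q). -/
/-- The multiset of cycle lengths of a permutation of a finite set, with fixed points
counted as cycles of length 1 (so the lengths sum to the cardinality of the set). -/
def fullCycleType {α : Type*} [Fintype α] [DecidableEq α] (σ : Equiv.Perm α) : Multiset ℕ :=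
  σ.cycleType + Multiset.replicate (Fintype.card α - σ.support.card) 1

open Equiv Function

/-- When the cyclic group generated by a permutation acts transitively, every
point has the order of the permutation as its minimal period. -/
theorem minimalPeriod_eq_orderOf_of_transitive {X : Type*} (α : Perm X)
    (hα : ∀ x y : X, ∃ k : ℕ, (α ^ k) x = y) (x : X) :
    minimalPeriod α x = orderOf α := by
  apply Nat.dvd_antisymm
  · apply IsPeriodicPt.minimalPeriod_dvd
    rw [IsPeriodicPt, IsFixedPt, Perm.iterate_eq_pow, pow_orderOf_eq_one, Perm.one_apply]
  · apply orderOf_dvd_of_pow_eq_one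
    ext y
    obtain ⟨k, rfl⟩ := hα x y
    have h : (α ^ minimalPeriod α x) x = x := by
      rw [← Perm.iterate_eq_pow, iterate_minimalPeriod]
    rw [← Perm.mul_apply, pow_mul_comm, Perm.mul_apply, h, Perm.one_apply]

theorem card_support_cycleOf_eq_minimalPeriod {X : Type*} [Fintype X] [DecidableEq X]
    (σ : Perm X) {x : X} (hx : σ x ≠ x) :
    (σ.cycleOf x).support.card = minimalPeriod σ x := by
  have hc := Perm.isCycle_cycleOf σ hx
  have hcx : σ.cycleOf x x ≠ x := by rwa [Perm.cycleOf_apply_self]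
  rw [← hc.orderOf]
  refine Nat.dvd_right_iff_eq.mp fun k => ?_
  rw [orderOf_dvd_iff_pow_eq_one, hc.pow_eq_one_iff' hcx, Perm.cycleOf_pow_apply_self,
    ← isPeriodicPt_iff_minimalPeriod_dvd, IsPeriodicPt, IsFixedPt, Perm.iterate_eq_pow]

theorem fullCycleType_eq_replicate {X : Type*} [Fintype X] [DecidableEq X] (σ : Perm X)
    {m n : ℕ} (hn : 0 < n) (hσ : ∀ x, minimalPeriod σ x = n) (hcard : Fintype.card X = m * n) :
    fullCycleType σ = Multiset.replicate m n := by
  obtain rfl | hn1 := eq_or_ne n 1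
  · obtain rfl : σ = 1 := by
      ext x
      exact minimalPeriod_eq_one_iff_isFixedPt.mp (hσ x)
    simp [fullCycleType, hcard]
  · have hmoved (x : X) : σ x ≠ x := fun h =>
      hn1 ((hσ x).symm.trans (minimalPeriod_eq_one_iff_isFixedPt.mpr h))
    have hsupp : σ.support = Finset.univ := by
      ext x
      simp [hmoved x]
    have hrep : σ.cycleType = Multiset.replicate σ.cycleType.card n := by
      rw [Multiset.eq_replicate_card]
      intro b hb
      rw [Perm.cycleType_def, Multiset.mem_map] at hb
      obtain ⟨c, hc, rfl⟩ := hb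
      obtain ⟨x, hx⟩ := (Perm.mem_cycleFactorsFinset_iff.mp hc).1.nonempty_support
      rw [Perm.cycle_is_cycleOf hx hc, comp_apply,
        card_support_cycleOf_eq_minimalPeriod σ (hmoved x), hσ]
    have hsum := σ.sum_cycleType
    rw [hrep, Multiset.sum_replicate, hsupp, Finset.card_univ, hcard, smul_eq_mul] at hsum
    rw [fullCycleType, hsupp, Finset.card_univ, Nat.sub_self, Multiset.replicate_zero, add_zero,
      hrep, Nat.eq_of_mul_eq_mul_right hn hsum]

/-- If `α` is a single cycle of length `p = |X|` on `X` (its cyclic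
group acts transitively and its order is `p`) and `β` is a single cycle of length
`q = |Y|` on `Y`, then the permutation `(x, y) ↦ (α x, β y)` of `X × Y` decomposes into
exactly `gcd(p, q)` disjoint cycles, each of length `lcm(p, q)`. -/
theorem statement7 {X Y : Type*} [Fintype X] [DecidableEq X] [Fintype Y] [DecidableEq Y]
    (p q : ℕ) (hX : Fintype.card X = p) (hY : Fintype.card Y = q)
    (α : Equiv.Perm X) (β : Equiv.Perm Y)
    (hα : (∀ x y : X, ∃ k : ℕ, (α ^ k) x = y) ∧ orderOf α = p)
    (hβ : (∀ x y : Y, ∃ k : ℕ, (β ^ k) x = y) ∧ orderOf β = q) :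
    fullCycleType (Equiv.prodCongr α β) =
      Multiset.replicate (Nat.gcd p q) (Nat.lcm p q) := by
  have hp : 0 < p := hα.2 ▸ orderOf_pos α
  have hq : 0 < q := hβ.2 ▸ orderOf_pos β
  refine fullCycleType_eq_replicate _ (Nat.lcm_pos hp hq) (fun x => ?_) ?_
  · rw [Equiv.prodCongr_apply, minimalPeriod_prodMap,
      minimalPeriod_eq_orderOf_of_transitive α hα.1,
      minimalPeriod_eq_orderOf_of_transitive β hβ.1, hα.2, hβ.2]
  · rw [Fintype.card_prod, hX, hY, Nat.gcd_mul_lcm]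
end

section
/- The number of orbits of the action of pairs of permutations (ρ, σ) ∈ Perm(Fin 3) × Perm(Fin 3) on Perm(Fin 3 → Bool) given by F ↦ ρ' ∘ F ∘ σ' equals 1172. -/
theorem induced_mul {n : ℕ} (a b : Equiv.Perm (Fin n)) :
    induced (a * b) = induced b * induced a := rfl

theorem induced_one {n : ℕ} : induced (1 : Equiv.Perm (Fin n)) = 1 := rfl

theorem induced_pow {n : ℕ} (a : Equiv.Perm (Fin n)) (k : ℕ) :
    induced (a ^ k) = induced a ^ k := by
  induction k with
  | zero => exact induced_one
  | succ k ih => rw [pow_succ, induced_mul, ih, ← pow_succ']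

theorem induced_inv {n : ℕ} (a : Equiv.Perm (Fin n)) : induced a⁻¹ = (induced a)⁻¹ := rfl

/-- A permutation of prime order `p` moving `k * p` points is a product of `k` disjoint
`p`-cycles. -/
theorem cycleType_eq_replicate_of_pow_prime_eq_one {α : Type*} [Fintype α] [DecidableEq α]
    {σ : Equiv.Perm α} {p k : ℕ} (hp : p.Prime) (hσ : σ ^ p = 1)
    (hk : σ.support.card = k * p) : σ.cycleType = Multiset.replicate k p := by
  have : Fact p.Prime := ⟨hp⟩
  have h := Equiv.Perm.cycleType_of_pow_prime_eq_one hσ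
  have hs := σ.sum_cycleType
  rw [h, Multiset.sum_replicate, smul_eq_mul, hk] at hs
  rw [h, Nat.eq_of_mul_eq_mul_right hp.pos hs]

/-- The number of solutions `F` of `g * F = F * h` in a finite symmetric group. -/
theorem natCard_intertwiners {α : Type*} [Fintype α] [DecidableEq α] (g h : Equiv.Perm α) :
    Nat.card {F : Equiv.Perm α // g * F = F * h} =
      if g.cycleType = h.cycleType then Nat.card (Subgroup.centralizer {h}) else 0 := by
  split_ifs with hgh
  · obtain ⟨c, hc⟩ := isConj_iff.1 (Equiv.Perm.isConj_iff_cycleType_eq.2 hgh.symm)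
    refine Nat.card_congr ((Equiv.mulLeft c⁻¹).subtypeEquiv fun F => ?_)
    rw [Subgroup.mem_centralizer_singleton_iff, ← hc, Equiv.coe_mulLeft]
    constructor
    · intro hF
      rw [mul_assoc, ← hF]
      group
    · intro hF
      rw [mul_assoc, mul_assoc, ← hF]
      group
  · have : IsEmpty {F : Equiv.Perm α // g * F = F * h} := ⟨fun ⟨F, hF⟩ => hgh <| by
      rw [← Equiv.Perm.cycleType_conj (σ := h) (τ := F), ← hF, mul_inv_cancel_right]⟩
    exact Nat.card_of_isEmpty

theorem perm_fin_three_cases : ∀ g : Equiv.Perm (Fin 3), g = 1 ∨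
    (g ^ 2 = 1 ∧ g.support.card = 2 ∧ (induced g).support.card = 4) ∨
    (g ^ 3 = 1 ∧ g.support.card = 3 ∧ (induced g).support.card = 6) := by decide +kernel

theorem cycleType_induced (g : Equiv.Perm (Fin 3)) :
    (induced g).cycleType =
      if g.support.card = 0 then 0 else Multiset.replicate 2 g.support.card := by
  rcases perm_fin_three_cases g with rfl | ⟨hg, hs, hi⟩ | ⟨hg, hs, hi⟩
  · simp [induced_one]
  · rw [cycleType_eq_replicate_of_pow_prime_eq_one (k := 2) Nat.prime_two
      (by rw [← induced_pow, hg, induced_one]) hi, hs, if_neg two_ne_zero]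
  · rw [cycleType_eq_replicate_of_pow_prime_eq_one (k := 2) Nat.prime_three
      (by rw [← induced_pow, hg, induced_one]) hi, hs, if_neg three_ne_zero]

theorem cycleType_induced_eq_iff (g h : Equiv.Perm (Fin 3)) :
    (induced g).cycleType = (induced h).cycleType ↔ g.support.card = h.support.card := by
  refine ⟨fun H => ?_, fun H => by rw [cycleType_induced, cycleType_induced, H]⟩
  have := congrArg Multiset.sum H
  rw [cycleType_induced, cycleType_induced] at this
  split_ifs at this <;>
    simp only [Multiset.sum_replicate, Multiset.sum_zero, smul_eq_mul] at this <;> omega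

theorem natCard_centralizer_induced (g : Equiv.Perm (Fin 3)) :
    Nat.card (Subgroup.centralizer {induced g}) =
      if g.support.card = 0 then 40320 else if g.support.card = 2 then 192 else 36 := by
  rw [Equiv.Perm.nat_card_centralizer, cycleType_induced]
  rcases perm_fin_three_cases g with rfl | ⟨-, hs, -⟩ | ⟨-, hs, -⟩
  · simp [Nat.factorial]
  · simp [hs, Nat.factorial]
  · simp [hs]

/-- Pairs `(ρ, σ)` act on the invertible maps by `F ↦ (ρ⁻¹)' ∘ F ∘ σ'`; the inverse makes this a
left action, since `σ ↦ σ'` reverses products. -/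
@[reducible]
def relabelAction (n : ℕ) :
    MulAction (Equiv.Perm (Fin n) × Equiv.Perm (Fin n)) (Equiv.Perm (Fin n → Bool)) where
  smul p F := induced p.1⁻¹ * F * induced p.2
  one_smul _ := rfl
  mul_smul _ _ _ := rfl

theorem natCard_quot_mul_eq_sum (n : ℕ) :
    Nat.card (Quot fun F H : Equiv.Perm (Fin n → Bool) =>
      ∃ ρ σ : Equiv.Perm (Fin n), H = induced ρ * F * induced σ) *
        Fintype.card (Equiv.Perm (Fin n) × Equiv.Perm (Fin n)) =
      ∑ a : Equiv.Perm (Fin n), ∑ b : Equiv.Perm (Fin n),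
        Nat.card {F : Equiv.Perm (Fin n → Bool) // induced a * F = F * induced b} := by
  classical
  let := relabelAction n
  have burnside := MulAction.sum_card_fixedBy_eq_card_orbits_mul_card_group
    (Equiv.Perm (Fin n) × Equiv.Perm (Fin n)) (Equiv.Perm (Fin n → Bool))
  have hquot : Nat.card (Quot fun F H : Equiv.Perm (Fin n → Bool) =>
      ∃ ρ σ : Equiv.Perm (Fin n), H = induced ρ * F * induced σ) =
      Nat.card (MulAction.orbitRel.Quotient (Equiv.Perm (Fin n) × Equiv.Perm (Fin n))
        (Equiv.Perm (Fin n → Bool))) := by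
    refine Nat.card_congr (Quot.congrRight fun F H => ?_)
    refine Iff.trans ?_ (MulAction.orbitRel (Equiv.Perm (Fin n) × Equiv.Perm (Fin n))
      (Equiv.Perm (Fin n → Bool))).comm
    constructor
    · rintro ⟨ρ, σ, rfl⟩
      exact ⟨(ρ⁻¹, σ), rfl⟩
    · rintro ⟨⟨ρ, σ⟩, rfl⟩
      exact ⟨ρ⁻¹, σ, rfl⟩
  rw [hquot, Nat.card_eq_fintype_card, ← burnside, Fintype.sum_prod_type]
  refine Finset.sum_congr rfl fun a _ => Finset.sum_congr rfl fun b _ => ?_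
  rw [← Nat.card_eq_fintype_card]
  refine Nat.card_congr (Equiv.subtypeEquivRight fun F => ?_)
  change induced a⁻¹ * F * induced b = F ↔ _
  rw [induced_inv, mul_assoc, inv_mul_eq_iff_eq_mul, eq_comm]

theorem sum_perm_fin_three : ∑ a : Equiv.Perm (Fin 3), ∑ b : Equiv.Perm (Fin 3),
    (if a.support.card = b.support.card then
      if b.support.card = 0 then 40320 else if b.support.card = 2 then 192 else 36
    else 0) = 42192 := by
  decide +kernel

/-- The number of equivalence classes of invertible maps
`(Fin 3 → Bool) → (Fin 3 → Bool)` under the action `F ↦ ρ' ∘ F ∘ σ'` of pairs of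
permutations of the input and output variables equals `1172`. -/
theorem statement13 :
    Nat.card (Quot fun F H : Equiv.Perm (Fin 3 → Bool) =>
      ∃ ρ σ : Equiv.Perm (Fin 3), H = induced ρ * F * induced σ) = 1172 := by
  have h := natCard_quot_mul_eq_sum 3
  simp only [natCard_intertwiners, cycleType_induced_eq_iff, natCard_centralizer_induced,
    sum_perm_fin_three] at h
  have hc : Fintype.card (Equiv.Perm (Fin 3) × Equiv.Perm (Fin 3)) = 36 := by
    simp [Fintype.card_perm, Nat.factorial]
  rw [hc] at h
  omega
end

section
/- The number of orbits of the action of pairs of permutations (ρ, σ) ∈ Perm(Fin 4) × Perm(Fin 4) on Perm(Fin 4 → Bool) given by F ↦ ρ' ∘ F ∘ σ' equals 36325278240. -/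
open Equiv

/-- The action of `G × G` on `H` by `(a, b) • x = φ a * x * (φ b)⁻¹`. -/
abbrev twoSidedAction {G H : Type*} [Group G] [Group H] (φ : G →* H) : MulAction (G × G) H where
  smul g x := φ g.1 * x * (φ g.2)⁻¹
  one_smul x := show φ 1 * x * (φ 1)⁻¹ = x by simp
  mul_smul g h x := show φ (g.1 * h.1) * x * (φ (g.2 * h.2))⁻¹ =
    φ g.1 * (φ h.1 * x * (φ h.2)⁻¹) * (φ g.2)⁻¹ by simp [mul_assoc]

/-- Burnside's lemma for the two-sided action of a finite group through a homomorphism. -/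
theorem sum_card_intertwiners_eq {G H : Type*} [Group G] [Group H] [Fintype G] [Finite H]
    (φ : G →* H) :
    ∑ a : G, ∑ b : G, Nat.card {x : H // φ a * x = x * φ b} =
      Nat.card (Quot fun x y : H => ∃ a b : G, y = φ a * x * (φ b)⁻¹) * Fintype.card G ^ 2 := by
  classical
  let := twoSidedAction φ
  have := Fintype.ofFinite H
  have burnside := MulAction.sum_card_fixedBy_eq_card_orbits_mul_card_group (G × G) H
  rw [Fintype.sum_prod_type, Fintype.card_prod, ← sq] at burnside
  convert burnside using 2
  · refine Finset.sum_congr rfl fun b _ => ?_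
    rw [← Nat.card_eq_fintype_card]
    refine Nat.card_congr (Equiv.subtypeEquivRight fun x => ?_)
    exact mul_inv_eq_iff_eq_mul.symm
  · rw [← Nat.card_eq_fintype_card]
    refine Nat.card_congr (Quot.congr (Equiv.refl H) fun x y => ?_)
    refine Iff.trans ?_ (MulAction.orbitRel (G × G) H).comm'
    exact ⟨fun ⟨a, b, h⟩ => ⟨(a, b), h.symm⟩, fun ⟨g, h⟩ => ⟨g.1, g.2, h.symm⟩⟩

/-- If `s` and `t` are conjugate, the elements conjugating `t` to `s` form a coset of the
centralizer of `t`; otherwise there are none. -/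
theorem card_intertwiners {H : Type*} [Group H] (s t : H) [Decidable (IsConj t s)] :
    Nat.card {x : H // s * x = x * t} =
      if IsConj t s then Nat.card (Subgroup.centralizer {t}) else 0 := by
  split_ifs with h
  · obtain ⟨c, rfl⟩ := isConj_iff.mp h
    refine Nat.card_congr (Equiv.subtypeEquiv (Equiv.mulLeft c⁻¹) fun x => ?_)
    rw [Subgroup.mem_centralizer_singleton_iff, Equiv.coe_mulLeft, eq_comm,
      ← mul_right_inj c⁻¹]
    simp only [mul_assoc, inv_mul_cancel_left]
  · rw [Nat.card_eq_zero]
    exact Or.inl ⟨fun ⟨x, hx⟩ => h (isConj_iff.mpr ⟨x, (eq_mul_inv_of_mul_eq hx).symm⟩)⟩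

/-- The homomorphism sending `σ` to the permutation induced by `σ⁻¹`. -/
def inducedHom (n : ℕ) : Perm (Fin n) →* Perm (Fin n → Bool) where
  toFun σ := induced σ⁻¹
  map_one' := rfl
  map_mul' _ _ := rfl

theorem inducedHom_inv {n : ℕ} (σ : Perm (Fin n)) : inducedHom n σ⁻¹ = induced σ := rfl

/-- The order of the centralizer of a permutation of `N` points with cycle type `m`. -/
def centralizerCard (N : ℕ) (m : Multiset ℕ) : ℕ :=
  (N - m.sum).factorial * m.prod * ∏ k ∈ m.toFinset, (m.count k).factorial

/-- The cycle type of the permutation of `Fin 4 → Bool` induced by `σ`. -/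
def inducedCycleType (σ : Perm (Fin 4)) : Multiset ℕ :=
  if σ = 1 then 0
  else if σ ^ 3 = 1 then Multiset.replicate 4 3
  else if σ ^ 2 ≠ 1 then {2, 4, 4, 4}
  else if ∃ i, σ i = i then Multiset.replicate 4 2
  else Multiset.replicate 6 2

/-- Representatives of the conjugacy classes of `Perm (Fin 4)`. -/
def conjRepresentatives : List (Perm (Fin 4)) :=
  [1, c[0, 1], c[0, 1] * c[2, 3], c[0, 1, 2], c[0, 1, 2, 3]]

theorem exists_conjRepresentative (σ : Perm (Fin 4)) :
    ∃ τ ∈ conjRepresentatives,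
      inducedCycleType τ = inducedCycleType σ ∧ ∃ c : Perm (Fin 4), c * τ * c⁻¹ = σ := by
  revert σ
  decide +kernel

theorem cycleType_inducedHom_of_mem_conjRepresentatives :
    ∀ τ ∈ conjRepresentatives, (inducedHom 4 τ).cycleType = inducedCycleType τ := by
  decide +kernel

theorem cycleType_inducedHom (σ : Perm (Fin 4)) :
    (inducedHom 4 σ).cycleType = inducedCycleType σ := by
  obtain ⟨τ, hτ, hτσ, c, rfl⟩ := exists_conjRepresentative σ
  rw [map_mul, map_mul, map_inv, Perm.cycleType_conj,
    cycleType_inducedHom_of_mem_conjRepresentatives τ hτ, hτσ]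

theorem card_intertwiners_inducedHom (ρ σ : Perm (Fin 4)) :
    Nat.card {F // inducedHom 4 ρ * F = F * inducedHom 4 σ} =
      if inducedCycleType σ = inducedCycleType ρ then
        centralizerCard 16 (inducedCycleType σ) else 0 := by
  classical
  rw [card_intertwiners]
  simp only [Perm.isConj_iff_cycleType_eq, Perm.nat_card_centralizer, cycleType_inducedHom]
  rfl

theorem sum_centralizerCard_inducedCycleType :
    (∑ ρ : Perm (Fin 4), ∑ σ : Perm (Fin 4),
      if inducedCycleType σ = inducedCycleType ρ then
        centralizerCard 16 (inducedCycleType σ) else 0) = 36325278240 * 24 ^ 2 := by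
  decide +kernel

/-- The number of equivalence classes of invertible maps
`(Fin 4 → Bool) → (Fin 4 → Bool)` under the action `F ↦ ρ' ∘ F ∘ σ'` of pairs of
permutations of the input and output variables equals `36325278240`. -/
theorem statement14 :
    Nat.card (Quot fun F H : Equiv.Perm (Fin 4 → Bool) =>
      ∃ ρ σ : Equiv.Perm (Fin 4), H = induced ρ * F * induced σ) = 36325278240 := by
  have orbits := sum_card_intertwiners_eq (inducedHom 4)
  simp only [card_intertwiners_inducedHom, sum_centralizerCard_inducedCycleType,
    Fintype.card_perm, Fintype.card_fin] at orbits
  have card_orbits := Nat.eq_of_mul_eq_mul_right (by norm_num) orbits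
  rw [card_orbits]
  refine Nat.card_congr (Quot.congr (Equiv.refl _) fun F H => ?_)
  simp only [← inducedHom_inv, map_inv]
  exact ⟨fun ⟨ρ, σ, h⟩ => ⟨ρ⁻¹, σ, by simpa using h⟩,
    fun ⟨ρ, σ, h⟩ => ⟨ρ⁻¹, σ, by simpa using h⟩⟩
end
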